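/- Let G be a locally compact topological group acting continuously on X and on Y. Then the map G × C(X,M(Y)) → C(X,M(Y)), (g,Ψ) ↦ π(g)Ψ, is jointly continuous when C(X,M(Y)) carries the compact-to-compact topology, i.e. the topology generated by the seminorms ‖Φ‖_{(C;K)} := sup{|Φ(x)(φ)| : x ∈ K, φ ∈ C} over all compact K ⊂ X and all subsets C ⊂ C_c(Y) that are contained and relatively compact in some C_A(Y) with A ⊂ Y compact. -/

import Mathlib

open scoped CompactlySupported

noncomputable section

variable (Y : Type*) [TopologicalSpace Y]

/-- The space `M(Y)` of complex Radon measures on `Y`, identified with the topological dual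
of `C_c(Y, ℂ)`: linear functionals bounded on the subspace `C_A(Y)` of functions supported
in any fixed compact set `A ⊆ Y`. -/
def RadonM : Submodule ℂ (C_c(Y, ℂ) →ₗ[ℂ] ℂ) where
  carrier := {μ | ∀ A : Set Y, IsCompact A → ∃ C : ℝ, ∀ φ : C_c(Y, ℂ),
      tsupport ⇑φ ⊆ A → (∀ x, ‖φ x‖ ≤ 1) → ‖μ φ‖ ≤ C}
  add_mem' := by
    intro μ ν hμ hν A hA
    obtain ⟨C₁, h₁⟩ := hμ A hA
    obtain ⟨C₂, h₂⟩ := hν A hA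
    refine ⟨C₁ + C₂, fun φ h h' => ?_⟩
    calc ‖(μ + ν) φ‖ = ‖μ φ + ν φ‖ := by simp
    _ ≤ ‖μ φ‖ + ‖ν φ‖ := norm_add_le _ _
    _ ≤ C₁ + C₂ := add_le_add (h₁ φ h h') (h₂ φ h h')
  zero_mem' := fun _ _ => ⟨0, fun φ _ _ => by simp⟩
  smul_mem' := by
    intro c μ hμ A hA
    obtain ⟨C, h⟩ := hμ A hA
    refine ⟨‖c‖ * C, fun φ hs hb => ?_⟩
    simp only [LinearMap.smul_apply, norm_smul]
    exact mul_le_mul_of_nonneg_left (h φ hs hb) (norm_nonneg c)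

variable {Y}
variable {X : Type*} [MetricSpace X]

/-- A map `Ψ : X → M(Y)` is weak*-continuous if `x ↦ Ψ(x)(φ)` is continuous for every
test function `φ ∈ C_c(Y, ℂ)`; these are the elements of `C(X, M(Y))`. -/
def WeakStarContinuous (Ψ : X → RadonM Y) : Prop :=
  ∀ φ : C_c(Y, ℂ), Continuous fun x => (Ψ x).1 φ

variable [T2Space Y]
variable {G : Type*} [Group G] [TopologicalSpace G] [IsTopologicalGroup G]
  [MulAction G Y] [ContinuousSMul G Y]

/-- The action of `G` on test functions: `(g·φ)(y) = φ(g⁻¹·y)`, as a linear map. -/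
def smulCcL (g : G) : C_c(Y, ℂ) →ₗ[ℂ] C_c(Y, ℂ) where
  toFun φ :=
    ⟨⟨fun y => φ (g⁻¹ • y), φ.continuous.comp (continuous_const_smul _)⟩,
      φ.hasCompactSupport'.comp_homeomorph (Homeomorph.smul g⁻¹)⟩
  map_add' φ ψ := by ext y; rfl
  map_smul' c φ := by ext y; simp; exact Or.inl rfl

lemma comp_smulCcL_mem (μ : RadonM Y) (g : G) :
    (μ : C_c(Y, ℂ) →ₗ[ℂ] ℂ).comp (smulCcL g) ∈ RadonM Y := by
  show ∀ A : Set Y, IsCompact A → ∃ C : ℝ, ∀ φ : C_c(Y, ℂ),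
      tsupport ⇑φ ⊆ A → (∀ x, ‖φ x‖ ≤ 1) → ‖((μ : C_c(Y, ℂ) →ₗ[ℂ] ℂ).comp (smulCcL g)) φ‖ ≤ C
  intro A hA
  obtain ⟨C, hC⟩ := μ.2 ((fun y => g • y) '' A) (hA.image (continuous_const_smul g))
  refine ⟨C, fun φ hsupp hb => ?_⟩
  refine hC _ ?_ (fun y => hb (g⁻¹ • y))
  have h1 : Function.support (fun y => φ (g⁻¹ • y)) ⊆ (fun y => g • y) '' A := by
    intro y hy
    have h2 : g⁻¹ • y ∈ tsupport ⇑φ := subset_tsupport _ hy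
    exact ⟨g⁻¹ • y, hsupp h2, by simp⟩
  exact closure_minimal h1 (hA.image (continuous_const_smul g)).isClosed

variable [MulAction G X] [ContinuousSMul G X]

/-- The representation `π` of `G` on maps `Ψ : X → M(Y)`:
`[π(g)Ψ](x)(φ) = Ψ(g⁻¹·x)(g⁻¹·φ)`, where `(g·φ)(y) = φ(g⁻¹·y)`. -/
def piAct (g : G) (Ψ : X → RadonM Y) : X → RadonM Y := fun x =>
  ⟨((Ψ (g⁻¹ • x)) : C_c(Y, ℂ) →ₗ[ℂ] ℂ).comp (smulCcL g⁻¹), comp_smulCcL_mem _ _⟩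


variable [LocallyCompactSpace Y] [SecondCountableTopology Y] [LocallyCompactSpace G]

/-- Relative compactness in the Banach space `C_A(Y)`: total boundedness in the sup norm. -/
def SupNormTotallyBounded (C : Set C_c(Y, ℂ)) : Prop :=
  ∀ ε : ℝ, 0 < ε → ∃ F : Finset C_c(Y, ℂ), ∀ φ ∈ C, ∃ ψ ∈ F, ∀ y, ‖φ y - ψ y‖ ≤ ε

/-- Functions vanishing outside `A`. -/
def CASub (A : Set Y) : Submodule ℂ (BoundedContinuousFunction Y ℂ) where
  carrier := {f | ∀ y, y ∉ A → f y = 0}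
  add_mem' := by
    intro f g hf hg y hy
    simp [hf y hy, hg y hy]
  zero_mem' := fun _ _ => rfl
  smul_mem' := by
    intro c f hf y hy
    simp [hf y hy]

lemma CASub_isClosed (A : Set Y) : IsClosed (CASub A : Set (BoundedContinuousFunction Y ℂ)) := by
  have : (CASub A : Set (BoundedContinuousFunction Y ℂ)) = ⋂ y, ⋂ (_ : y ∉ A), {f | f y = 0} := by
    ext f; simp only [Set.mem_iInter]; rfl
  rw [this]
  refine isClosed_iInter fun y => isClosed_iInter fun _ => ?_
  exact isClosed_eq (BoundedContinuousFunction.lipschitz_eval_const y).continuous continuous_const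

def CAtoCc (A : Set Y) (hA : IsCompact A) : CASub A →ₗ[ℂ] C_c(Y, ℂ) where
  toFun f := ⟨⟨f.1, f.1.continuous⟩, HasCompactSupport.intro hA (fun y hy => f.2 y hy)⟩
  map_add' f g := by ext y; rfl
  map_smul' c f := by ext y; rfl

lemma radon_bound (A : Set Y) (hA : IsCompact A) (μ : RadonM Y) :
    ∃ c : ℝ, ∀ f : CASub A, ‖μ.1 (CAtoCc A hA f)‖ ≤ c * ‖f‖ := by
  obtain ⟨c, hc⟩ := μ.2 A hA
  refine ⟨c, fun f => ?_⟩
  by_cases hf : ‖f‖ = 0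
  · have : f = 0 := norm_eq_zero.1 hf
    subst this
    simp
  have hpos : 0 < ‖f‖ := lt_of_le_of_ne (norm_nonneg _) (Ne.symm hf)
  have h := hc (CAtoCc A hA (((‖f‖⁻¹ : ℝ) : ℂ) • f)) ?_ ?_
  · rw [map_smul, map_smul, norm_smul] at h
    simp only [Complex.norm_real, norm_inv, norm_norm] at h
    rwa [inv_mul_le_iff₀ hpos, mul_comm] at h
  · refine closure_minimal ?_ hA.isClosed
    intro y hy
    by_contra hyA
    exact hy ((((‖f‖⁻¹ : ℝ) : ℂ) • f).2 y hyA)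
  · intro y
    have h1 : ‖f.1 y‖ ≤ ‖f‖ := f.1.norm_coe_le_norm y
    have : CAtoCc A hA (((‖f‖⁻¹ : ℝ) : ℂ) • f) y = ((‖f‖⁻¹ : ℝ) : ℂ) * f.1 y := rfl
    rw [this, norm_mul, Complex.norm_real, norm_inv, norm_norm, inv_mul_le_iff₀ hpos, mul_one]
    exact h1

lemma uniform_bound (Ψ : X → RadonM Y) (hΨ : WeakStarContinuous Ψ)
    (K : Set X) (hK : IsCompact K) (A : Set Y) (hA : IsCompact A) :
    ∃ M : ℝ, 0 ≤ M ∧ ∀ x ∈ K, ∀ φ : C_c(Y, ℂ), tsupport ⇑φ ⊆ A → ∀ r : ℝ, 0 ≤ r →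
      (∀ y, ‖φ y‖ ≤ r) → ‖(Ψ x).1 φ‖ ≤ M * r := by
  choose c hc using fun x => radon_bound A hA (Ψ x)
  have : CompleteSpace (CASub A) := (CASub_isClosed A).completeSpace_coe
  let T : K → (CASub A →L[ℂ] ℂ) := fun x =>
    LinearMap.mkContinuous ((Ψ x).1.comp (CAtoCc A hA)) (c x) (hc x)
  have hT : ∃ M, ∀ x, ‖T x‖ ≤ M := by
    apply banach_steinhaus
    intro f
    obtain ⟨b, hb⟩ := hK.exists_bound_of_continuousOn (hΨ (CAtoCc A hA f)).continuousOn
    exact ⟨b, fun x => hb x x.2⟩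
  obtain ⟨M, hM⟩ := hT
  refine ⟨max M 0, le_max_right _ _, fun x hx φ hφ r hr hb => ?_⟩
  let f₀ : BoundedContinuousFunction Y ℂ :=
    BoundedContinuousFunction.ofNormedAddCommGroup φ φ.continuous r hb
  let f : CASub A := ⟨f₀, fun y hy => by
    by_contra h
    exact hy (hφ (subset_tsupport _ h))⟩
  have hfφ : CAtoCc A hA f = φ := by ext y; rfl
  have hfr : ‖f‖ ≤ r := (BoundedContinuousFunction.norm_le hr).2 hb
  have h1 : ‖T ⟨x, hx⟩ f‖ ≤ ‖T ⟨x, hx⟩‖ * ‖f‖ := (T ⟨x, hx⟩).le_opNorm f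
  have h2 : T ⟨x, hx⟩ f = (Ψ x).1 φ := by
    rw [← hfφ]; rfl
  rw [h2] at h1
  exact h1.trans (mul_le_mul ((hM _).trans (le_max_left _ _)) hfr (norm_nonneg _)
    (le_max_right _ _))

lemma smul_apply_aux (g : G) (φ : C_c(Y, ℂ)) (y : Y) : smulCcL g⁻¹ φ y = φ (g • y) := by
  show φ (g⁻¹⁻¹ • y) = _
  rw [inv_inv]

lemma compact_inv_smul {Z : Type*} [TopologicalSpace Z] [MulAction G Z] [ContinuousSMul G Z]
    (N : Set G) (hN : IsCompact N) (A : Set Z) (hA : IsCompact A) :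
    IsCompact ((fun p : G × Z => p.1⁻¹ • p.2) '' (N ×ˢ A)) :=
  (hN.prod hA).image (by fun_prop)

lemma tsupport_aux (N : Set G) (hN : IsCompact N) (A : Set Y) (hA : IsCompact A)
    (g : G) (hg : g ∈ N) (φ : C_c(Y, ℂ)) (hφ : tsupport ⇑φ ⊆ A) :
    tsupport ⇑(smulCcL g⁻¹ φ) ⊆ (fun p : G × Y => p.1⁻¹ • p.2) '' (N ×ˢ A) := by
  refine closure_minimal ?_ (compact_inv_smul N hN A hA).isClosed
  intro y hy
  rw [Function.mem_support, smul_apply_aux] at hy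
  exact ⟨(g, g • y), ⟨hg, hφ (subset_tsupport _ hy)⟩, by simp⟩

lemma sup_cont (φ : C_c(Y, ℂ)) (g₁ : G) (ε : ℝ) (hε : 0 < ε) :
    ∀ᶠ g in nhds g₁, ∀ y, ‖φ (g • y) - φ (g₁ • y)‖ ≤ ε := by
  obtain ⟨N, hN, hN1⟩ := exists_compact_mem_nhds g₁
  have hA : IsCompact (tsupport ⇑φ) := φ.hasCompactSupport'
  set B := (fun p : G × Y => p.1⁻¹ • p.2) '' (N ×ˢ tsupport ⇑φ) with hB
  have hBc : IsCompact B := compact_inv_smul N hN _ hA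
  have hz : ∀ g ∈ N, ∀ y, y ∉ B → φ (g • y) = 0 := by
    intro g hg y hy
    by_contra h
    exact hy ⟨(g, g • y), ⟨hg, subset_tsupport _ h⟩, by simp⟩
  have h1 : ∀ᶠ g in nhds g₁, ∀ y ∈ B, ‖φ (g • y) - φ (g₁ • y)‖ < ε := by
    refine hBc.eventually_forall_of_forall_eventually fun y _ => ?_
    have hφ := φ.continuous
    have hc : Continuous fun p : G × Y => ‖φ (p.1 • p.2) - φ (g₁ • p.2)‖ := by
      exact ((hφ.comp continuous_smul).sub (hφ.comp (by fun_prop))).norm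
    exact hc.continuousAt.eventually_lt_const (by simpa using hε)
  filter_upwards [h1, hN1] with g hg hgN y
  by_cases hy : y ∈ B
  · exact (hg y hy).le
  · rw [hz g hgN y hy, hz g₁ (mem_of_mem_nhds hN1) y hy]
    simpa using hε.le

lemma net_in (C : Set C_c(Y, ℂ)) (hC : SupNormTotallyBounded C) (ε : ℝ) (hε : 0 < ε) :
    ∃ F : Finset C_c(Y, ℂ), (∀ ψ ∈ F, ψ ∈ C) ∧ ∀ φ ∈ C, ∃ ψ ∈ F, ∀ y, ‖φ y - ψ y‖ ≤ ε := by
  classical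
  obtain ⟨F, hF⟩ := hC (ε / 2) (half_pos hε)
  let P : C_c(Y, ℂ) → Prop := fun ψ => ∃ φ ∈ C, ∀ y, ‖φ y - ψ y‖ ≤ ε / 2
  let s : C_c(Y, ℂ) → C_c(Y, ℂ) := fun ψ => if h : P ψ then h.choose else 0
  have hs : ∀ ψ, P ψ → s ψ ∈ C ∧ ∀ y, ‖s ψ y - ψ y‖ ≤ ε / 2 := by
    intro ψ h
    simp only [s, dif_pos h]
    exact h.choose_spec
  refine ⟨(F.filter P).image s, ?_, ?_⟩
  · intro ψ hψ
    obtain ⟨χ, hχ, rfl⟩ := Finset.mem_image.1 hψ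
    exact (hs χ (Finset.mem_filter.1 hχ).2).1
  · intro φ hφ
    obtain ⟨ψ, hψ, h⟩ := hF φ hφ
    have hP : P ψ := ⟨φ, hφ, h⟩
    refine ⟨s ψ, Finset.mem_image_of_mem _ (Finset.mem_filter.2 ⟨hψ, hP⟩), fun y => ?_⟩
    have h1 := h y
    have h2 := (hs ψ hP).2 y
    rw [norm_sub_rev] at h2
    have h3 := norm_sub_le_norm_sub_add_norm_sub (φ y) (ψ y) (s ψ y)
    linarith

lemma tb_aux (N : Set G) (hN : IsCompact N) (C : Set C_c(Y, ℂ)) (hC : SupNormTotallyBounded C) :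
    SupNormTotallyBounded {χ | ∃ g ∈ N, ∃ φ ∈ C, χ = smulCcL g⁻¹ φ} := by
  classical
  intro ε hε
  obtain ⟨F, hF⟩ := hC (ε / 2) (half_pos hε)
  have h1 : ∀ g₁ ∈ N, {g | ∀ ψ ∈ F, ∀ y, ‖ψ (g • y) - ψ (g₁ • y)‖ ≤ ε / 2} ∈ nhds g₁ := by
    intro g₁ _
    exact (Filter.eventually_all_finset F).2 fun ψ _ => sup_cont ψ g₁ _ (half_pos hε)
  obtain ⟨t, _, ht⟩ := hN.elim_nhds_subcover _ h1
  refine ⟨(t ×ˢ F).image (fun p => smulCcL p.1⁻¹ p.2), ?_⟩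
  rintro _ ⟨g, hg, φ, hφ, rfl⟩
  obtain ⟨ψ, hψ, h⟩ := hF φ hφ
  obtain ⟨g₁, hg₁, hgg⟩ := Set.mem_iUnion₂.1 (ht hg)
  refine ⟨smulCcL g₁⁻¹ ψ, Finset.mem_image.2 ⟨(g₁, ψ), Finset.mem_product.2 ⟨hg₁, hψ⟩, rfl⟩,
    fun y => ?_⟩
  rw [smul_apply_aux, smul_apply_aux]
  have h2 := hgg ψ hψ y
  have h3 := h (g • y)
  have h4 := norm_sub_le_norm_sub_add_norm_sub (φ (g • y)) (ψ (g • y)) (ψ (g₁ • y))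
  linarith

/-- The map `(g, Ψ) ↦ π(g)Ψ` is jointly continuous for the
compact-to-compact topology on `C(X, M(Y))` (the topology generated by the seminorms
`‖·‖_{(C;K)}` over compact `K ⊆ X` and sets `C` of test functions supported in a common
compact set and relatively compact in sup norm; this family of seminorms is directed, so
continuity can be tested against a single seminorm of the same kind). -/
theorem piAct_jointly_continuous_compact_to_compact
    (Ψ₀ : X → RadonM Y) (hΨ₀ : WeakStarContinuous Ψ₀) (g₀ : G)
    (K : Set X) (hK : IsCompact K) (A : Set Y) (hA : IsCompact A)
    (C : Set C_c(Y, ℂ)) (hCA : ∀ φ ∈ C, tsupport ⇑φ ⊆ A) (hC : SupNormTotallyBounded C) :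
    ∀ ε : ℝ, 0 < ε → ∃ V ∈ nhds g₀, ∃ (A' : Set Y) (K' : Set X) (C' : Set C_c(Y, ℂ)) (δ : ℝ),
      IsCompact A' ∧ IsCompact K' ∧ (∀ φ ∈ C', tsupport ⇑φ ⊆ A') ∧
      SupNormTotallyBounded C' ∧ 0 < δ ∧
      ∀ g ∈ V, ∀ Ψ : X → RadonM Y, WeakStarContinuous Ψ →
        (∀ x ∈ K', ∀ φ ∈ C', ‖(Ψ x).1 φ - (Ψ₀ x).1 φ‖ ≤ δ) →
        ∀ x ∈ K, ∀ φ ∈ C, ‖(piAct g Ψ x).1 φ - (piAct g₀ Ψ₀ x).1 φ‖ ≤ ε := by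
  intro ε hε
  obtain ⟨N, hN, hN1⟩ := exists_compact_mem_nhds g₀
  have hg₀N : g₀ ∈ N := mem_of_mem_nhds hN1
  have hA' := compact_inv_smul N hN A hA
  have hK' := compact_inv_smul N hN K hK
  obtain ⟨M, hM0, hM⟩ := uniform_bound Ψ₀ hΨ₀ _ hK' _ hA'
  set η := ε / (8 * (M + 1)) with hη
  have hη0 : 0 < η := by positivity
  have hMη : M * η ≤ ε / 8 := by
    have : (M + 1) * η = ε / 8 := by rw [hη]; field_simp
    nlinarith
  obtain ⟨F, hFC, hF⟩ := net_in C hC η hη0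
  have hV1 : ∀ᶠ g in nhds g₀, ∀ ψ ∈ F, ∀ y, ‖ψ (g • y) - ψ (g₀ • y)‖ ≤ η :=
    (Filter.eventually_all_finset F).2 fun ψ _ => sup_cont ψ g₀ _ hη0
  have hV2 : ∀ᶠ g in nhds g₀, ∀ ψ ∈ F, ∀ x ∈ K,
      ‖(Ψ₀ (g⁻¹ • x)).1 (smulCcL g₀⁻¹ ψ) - (Ψ₀ (g₀⁻¹ • x)).1 (smulCcL g₀⁻¹ ψ)‖ < ε / 8 := by
    refine (Filter.eventually_all_finset F).2 fun ψ _ => ?_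
    refine hK.eventually_forall_of_forall_eventually fun x _ => ?_
    have hc := hΨ₀ (smulCcL g₀⁻¹ ψ)
    have hc2 : Continuous fun p : G × X =>
        ‖(Ψ₀ (p.1⁻¹ • p.2)).1 (smulCcL g₀⁻¹ ψ) - (Ψ₀ (g₀⁻¹ • p.2)).1 (smulCcL g₀⁻¹ ψ)‖ :=
      ((hc.comp (f := fun p : G × X => p.1⁻¹ • p.2) (by fun_prop)).sub
        (hc.comp (f := fun p : G × X => g₀⁻¹ • p.2) (by fun_prop))).norm
    exact hc2.continuousAt.eventually_lt_const (by simpa using hε)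
  refine ⟨_, Filter.inter_mem hN1 (Filter.inter_mem hV1 hV2), _, _,
    {χ | ∃ g ∈ N, ∃ φ ∈ C, χ = smulCcL g⁻¹ φ}, ε / 2, hA', hK', ?_, tb_aux N hN C hC,
    half_pos hε, ?_⟩
  · rintro _ ⟨g, hg, φ, hφ, rfl⟩
    exact tsupport_aux N hN A hA g hg φ (hCA φ hφ)
  rintro g ⟨hgN, hg1, hg2⟩ Ψ _ hΨ x hx φ hφ
  have hxg : ∀ g ∈ N, g⁻¹ • x ∈ (fun p : G × X => p.1⁻¹ • p.2) '' (N ×ˢ K) :=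
    fun g hg => ⟨(g, x), ⟨hg, hx⟩, rfl⟩
  obtain ⟨ψ, hψ, hφψ⟩ := hF φ hφ
  have e1 := hΨ _ (hxg g hgN) _ ⟨g, hgN, φ, hφ, rfl⟩
  have key : ∀ (z : X), z ∈ (fun p : G × X => p.1⁻¹ • p.2) '' (N ×ˢ K) →
      ∀ a b : C_c(Y, ℂ), tsupport ⇑a ⊆ (fun p : G × Y => p.1⁻¹ • p.2) '' (N ×ˢ A) →
      tsupport ⇑b ⊆ (fun p : G × Y => p.1⁻¹ • p.2) '' (N ×ˢ A) →
      (∀ y, ‖a y - b y‖ ≤ η) → ‖(Ψ₀ z).1 a - (Ψ₀ z).1 b‖ ≤ ε / 8 := by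
    intro z hz a b ha hb hab
    rw [← map_sub]
    refine (hM z hz (a - b) ?_ η hη0.le ?_).trans hMη
    · refine closure_minimal ?_ hA'.isClosed
      intro y hy
      by_contra hyA
      have h1 : a y = 0 := image_eq_zero_of_notMem_tsupport fun h => hyA (ha h)
      have h2 : b y = 0 := image_eq_zero_of_notMem_tsupport fun h => hyA (hb h)
      apply hy
      show a y - b y = 0
      rw [h1, h2, sub_zero]
    · exact hab
  have ts : ∀ g ∈ N, ∀ φ ∈ C, tsupport ⇑(smulCcL g⁻¹ φ) ⊆
      (fun p : G × Y => p.1⁻¹ • p.2) '' (N ×ˢ A) :=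
    fun g hg φ hφ => tsupport_aux N hN A hA g hg φ (hCA φ hφ)
  have hψC := hFC ψ hψ
  have e2 := key _ (hxg g hgN) _ _ (ts g hgN φ hφ) (ts g hgN ψ hψC) (fun y => by
    rw [smul_apply_aux, smul_apply_aux]; exact hφψ _)
  have e3 := key _ (hxg g hgN) _ _ (ts g hgN ψ hψC) (ts g₀ hg₀N ψ hψC) (fun y => by
    rw [smul_apply_aux, smul_apply_aux]; exact hg1 ψ hψ y)
  have e4 := (hg2 ψ hψ x hx).le
  have e5 := key _ (hxg g₀ hg₀N) _ _ (ts g₀ hg₀N ψ hψC) (ts g₀ hg₀N φ hφ) (fun y => by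
    rw [smul_apply_aux, smul_apply_aux, norm_sub_rev]; exact hφψ _)
  show ‖(Ψ (g⁻¹ • x)).1 (smulCcL g⁻¹ φ) - (Ψ₀ (g₀⁻¹ • x)).1 (smulCcL g₀⁻¹ φ)‖ ≤ ε
  have t1 := norm_sub_le_norm_sub_add_norm_sub ((Ψ (g⁻¹ • x)).1 (smulCcL g⁻¹ φ))
    ((Ψ₀ (g⁻¹ • x)).1 (smulCcL g⁻¹ φ)) ((Ψ₀ (g₀⁻¹ • x)).1 (smulCcL g₀⁻¹ φ))
  have t2 := norm_sub_le_norm_sub_add_norm_sub ((Ψ₀ (g⁻¹ • x)).1 (smulCcL g⁻¹ φ))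
    ((Ψ₀ (g⁻¹ • x)).1 (smulCcL g⁻¹ ψ)) ((Ψ₀ (g₀⁻¹ • x)).1 (smulCcL g₀⁻¹ φ))
  have t3 := norm_sub_le_norm_sub_add_norm_sub ((Ψ₀ (g⁻¹ • x)).1 (smulCcL g⁻¹ ψ))
    ((Ψ₀ (g⁻¹ • x)).1 (smulCcL g₀⁻¹ ψ)) ((Ψ₀ (g₀⁻¹ • x)).1 (smulCcL g₀⁻¹ φ))
  have t4 := norm_sub_le_norm_sub_add_norm_sub ((Ψ₀ (g⁻¹ • x)).1 (smulCcL g₀⁻¹ ψ))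
    ((Ψ₀ (g₀⁻¹ • x)).1 (smulCcL g₀⁻¹ ψ)) ((Ψ₀ (g₀⁻¹ • x)).1 (smulCcL g₀⁻¹ φ))
  linarith


end
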